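/- arXiv:math/0303088 — 7 statements merged into one kernel-verified Lean document; each statement's English description precedes it below -/
import Mathlib

section
/- For generic input N_1,…,N_{n−2}, W_1,…,W_{n−2} and τJ_0,…,τJ_n for J = 1,2,3 (i.e., all these values are nonzero and the values τ0_1,…,τ0_{n−1} determined by equations ⟨2,1⟩–⟨2,n−1⟩ are nonzero), there exists a unique solution of the system of equations ⟨J,i⟩ (1 ≤ J ≤ 4, 1 ≤ i ≤ n−1) in the unknowns S_1,…,S_{n−2}, E_1,…,E_{n−2}, τ0_1,…,τ0_{n−1} and τ4_0,…,τ4_n. -/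
/-- The `D^(1)_n` bilinear equation `⟨J,i⟩` on the tau functions. -/
def BE {F : Type*} [Field F] (n : ℕ)
    (lam lamb kap kapb S W N E t0 t1 t2 t3 t4 : ℕ → F)
    (α β : F) (J i : ℕ) : Prop :=
  if J = 1 then
    if i = 0 then kapb 1 * N 1 * t4 1 - lamb 1 * E 1 * t2 1 = α * t0 0 * t1 0
    else if i = 1 then kap 1 * N 1 * t4 0 - lam 1 * E 1 * t2 0 = α * t0 1 * t1 1
    else if i = n - 1 then
      kap (n - 1) * kap n * E (n - 2) * t2 n - lam (n - 1) * lam n * N (n - 2) * t4 n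
        = α * t0 (n - 1) * t1 n
    else if i = n then
      kap (n - 1) * E (n - 2) * t2 (n - 1) - lam (n - 1) * N (n - 2) * t4 (n - 1)
        = α * t0 n * t1 (n - 1)
    else kap i * E (i - 1) * N i - lam i * N (i - 1) * E i = α * t0 i * t1 i
  else if J = 2 then
    if i = 0 then kap 1 * N 1 * t3 1 + lamb 1 * W 1 * t1 1 = β * t0 0 * t2 0
    else if i = 1 then kapb 1 * N 1 * t3 0 + lam 1 * W 1 * t1 0 = β * t0 1 * t2 1
    else if i = n - 1 then
      kap n * kapb (n - 1) * W (n - 2) * t1 (n - 1) + lam (n - 1) * N (n - 2) * t3 (n - 1)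
        = β * t0 (n - 1) * t2 (n - 1)
    else if i = n then
      kapb (n - 1) * W (n - 2) * t1 n + lam (n - 1) * lam n * N (n - 2) * t3 n
        = β * t0 n * t2 n
    else kapb i * W (i - 1) * N i + lam i * N (i - 1) * W i = β * t0 i * t2 i
  else if J = 3 then
    if i = 0 then kap 1 * S 1 * t2 1 - lam 1 * W 1 * t4 1 = α * t0 0 * t3 0
    else if i = 1 then kapb 1 * S 1 * t2 0 - lamb 1 * W 1 * t4 0 = α * t0 1 * t3 1
    else if i = n - 1 then
      kapb (n - 1) * W (n - 2) * t4 n - lamb (n - 1) * S (n - 2) * t2 n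
        = α * t0 (n - 1) * t3 n
    else if i = n then
      kap n * kapb (n - 1) * W (n - 2) * t4 (n - 1) - lam n * lamb (n - 1) * S (n - 2) * t2 (n - 1)
        = α * t0 n * t3 (n - 1)
    else kapb i * W (i - 1) * S i - lamb i * S (i - 1) * W i = α * t0 i * t3 i
  else if J = 4 then
    if i = 0 then kapb 1 * S 1 * t1 1 + lam 1 * E 1 * t3 1 = β * t0 0 * t4 0
    else if i = 1 then kap 1 * S 1 * t1 0 + lamb 1 * E 1 * t3 0 = β * t0 1 * t4 1
    else if i = n - 1 then
      kap (n - 1) * E (n - 2) * t3 (n - 1) + lam n * lamb (n - 1) * S (n - 2) * t1 (n - 1)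
        = β * t0 (n - 1) * t4 (n - 1)
    else if i = n then
      kap (n - 1) * kap n * E (n - 2) * t3 n + lamb (n - 1) * S (n - 2) * t1 n
        = β * t0 n * t4 n
    else kap i * E (i - 1) * S i + lamb i * S (i - 1) * E i = β * t0 i * t4 i
  else True

/-- Every solution of an affine first-order recursion has its `m`-th term given by the same affine
function of the initial term. -/
theorem exists_affine_recursion_eq {F : Type*} [Field F] (a b c : ℕ → F) (m : ℕ) :
    ∃ u : F, ∀ e : ℕ → F, (∀ i < m, a i * e i - b i * e (i + 1) = c i) →
      (∏ i ∈ Finset.range m, b i) * e m = (∏ i ∈ Finset.range m, a i) * e 0 + u := by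
  induction m with
  | zero => exact ⟨0, fun e _ => by simp⟩
  | succ m ih =>
    obtain ⟨u, hu⟩ := ih
    refine ⟨a m * u - (∏ i ∈ Finset.range m, b i) * c m, fun e he => ?_⟩
    have h₁ := hu e fun i hi => he i (by omega)
    have h₂ := he m (by omega)
    rw [Finset.prod_range_succ, Finset.prod_range_succ]
    linear_combination a m * h₁ - (∏ i ∈ Finset.range m, b i) * h₂

/-- An affine first-order recursion with invertible leading coefficients has a solution with any
initial term. -/
theorem exists_affine_recursion {F : Type*} [Field F] (a b c : ℕ → F) (m : ℕ)
    (hb : ∀ i < m, b i ≠ 0) (x : F) :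
    ∃ e : ℕ → F, e 0 = x ∧ ∀ i < m, a i * e i - b i * e (i + 1) = c i := by
  refine ⟨fun i => Nat.rec x (fun j y => (a j * y - c j) / b j) i, rfl, fun i hi => ?_⟩
  have := hb i hi
  field_simp
  ring

/-- Two solutions of an affine first-order recursion with the same initial term agree. -/
theorem affine_recursion_unique {F : Type*} [Field F] {a b c e e' : ℕ → F} {m : ℕ}
    (hb : ∀ i < m, b i ≠ 0) (he : ∀ i < m, a i * e i - b i * e (i + 1) = c i)
    (he' : ∀ i < m, a i * e' i - b i * e' (i + 1) = c i) (h : e' 0 = e 0) :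
    ∀ i ≤ m, e' i = e i := by
  intro i
  induction i with
  | zero => exact fun _ => h
  | succ i ih =>
    intro hi
    refine mul_left_cancel₀ (hb i hi) ?_
    linear_combination a i * ih (by omega) + he i hi - he' i hi

/-- A pair of affine recursions with common ends has a unique solution when the products of the
coefficients around the cycle differ. -/
theorem exists_unique_affine_cycle {F : Type*} [Field F] (a b c p q d : ℕ → F) (m : ℕ)
    (hb : ∀ i < m, b i ≠ 0) (hp : ∀ i < m, p i ≠ 0)
    (h : (∏ i ∈ Finset.range m, a i) * ∏ i ∈ Finset.range m, p i ≠
      (∏ i ∈ Finset.range m, b i) * ∏ i ∈ Finset.range m, q i) :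
    ∃ e s : ℕ → F, (e 0 = s 0 ∧ e m = s m ∧ (∀ i < m, a i * e i - b i * e (i + 1) = c i) ∧
        ∀ i < m, p i * s (i + 1) - q i * s i = d i) ∧
      ∀ e' s' : ℕ → F, e' 0 = s' 0 → e' m = s' m →
        (∀ i < m, a i * e' i - b i * e' (i + 1) = c i) →
        (∀ i < m, p i * s' (i + 1) - q i * s' i = d i) → ∀ i ≤ m, e' i = e i ∧ s' i = s i := by
  obtain ⟨u, hu⟩ := exists_affine_recursion_eq a b c m
  obtain ⟨v, hv⟩ := exists_affine_recursion_eq q p (fun i => -d i) m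
  have hB : ∏ i ∈ Finset.range m, b i ≠ 0 :=
    Finset.prod_ne_zero_iff.2 fun i hi => hb i (Finset.mem_range.1 hi)
  have hP : ∏ i ∈ Finset.range m, p i ≠ 0 :=
    Finset.prod_ne_zero_iff.2 fun i hi => hp i (Finset.mem_range.1 hi)
  generalize (∏ i ∈ Finset.range m, a i) = A at *
  generalize (∏ i ∈ Finset.range m, b i) = B at *
  generalize (∏ i ∈ Finset.range m, p i) = P at *
  generalize (∏ i ∈ Finset.range m, q i) = Q at *
  have hD : A * P - B * Q ≠ 0 := sub_ne_zero.2 h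
  obtain ⟨e, he0, he⟩ := exists_affine_recursion a b c m hb ((B * v - P * u) / (A * P - B * Q))
  obtain ⟨s, hs0, hs⟩ :=
    exists_affine_recursion q p (fun i => -d i) m hp ((B * v - P * u) / (A * P - B * Q))
  have hx : (A * P - B * Q) * e 0 = B * v - P * u := by rw [he0]; field_simp
  have hes : e 0 = s 0 := he0.trans hs0.symm
  refine ⟨e, s, ⟨hes, ?_, he, fun i hi => by linear_combination -hs i hi⟩,
    fun e' s' h0 hm he' hs' i hi => ?_⟩
  · refine mul_left_cancel₀ (mul_ne_zero hB hP) ?_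
    linear_combination P * hu e he - B * hv s hs + hx + B * Q * hes
  · have hs'' : ∀ i < m, q i * s' i - p i * s' (i + 1) = -d i := fun i hi => by
      linear_combination -hs' i hi
    have h00 : e' 0 = e 0 := by
      refine mul_left_cancel₀ hD ?_
      linear_combination -P * hu e' he' + B * hv s' hs'' - hx + P * B * hm - B * Q * h0
    exact ⟨affine_recursion_unique hb he he' h00 i hi,
      affine_recursion_unique hp hs hs'' (h0.symm.trans (h00.trans hes)) i hi⟩

/-- The bilinear form of `exists_unique_affine_cycle`, with weights `N` and `W` that agree at both
ends. -/
theorem exists_unique_bilinear_cycle {F : Type*} [Field F] (a b c p q d N W : ℕ → F) (m : ℕ)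
    (hb : ∀ i < m, b i ≠ 0) (hp : ∀ i < m, p i ≠ 0)
    (hN : ∀ i ≤ m, N i ≠ 0) (hW : ∀ i ≤ m, W i ≠ 0) (h0 : N 0 = W 0) (hm : N m = W m)
    (h : (∏ i ∈ Finset.range m, a i) * ∏ i ∈ Finset.range m, p i ≠
      (∏ i ∈ Finset.range m, b i) * ∏ i ∈ Finset.range m, q i) :
    ∃ E S : ℕ → F, (E 0 = S 0 ∧ E m = S m ∧
        (∀ i < m, a i * E i * N (i + 1) - b i * N i * E (i + 1) = c i) ∧
        ∀ i < m, p i * W i * S (i + 1) - q i * S i * W (i + 1) = d i) ∧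
      ∀ E' S' : ℕ → F, E' 0 = S' 0 → E' m = S' m →
        (∀ i < m, a i * E' i * N (i + 1) - b i * N i * E' (i + 1) = c i) →
        (∀ i < m, p i * W i * S' (i + 1) - q i * S' i * W (i + 1) = d i) →
        ∀ i ≤ m, E' i = E i ∧ S' i = S i := by
  obtain ⟨e, s, ⟨he0, hem, he, hs⟩, huniq⟩ := exists_unique_affine_cycle a b
    (fun i => c i / (N i * N (i + 1))) p q (fun i => d i / (W i * W (i + 1))) m hb hp h
  refine ⟨fun i => N i * e i, fun i => W i * s i,
    ⟨by simp only [h0, he0], by simp only [hm, hem], fun i hi => ?_, fun i hi => ?_⟩,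
    fun E' S' h0' hm' hE' hS' i hi => ?_⟩
  · have h₁ := hN i hi.le
    have h₂ := hN (i + 1) hi
    have := he i hi
    rw [eq_div_iff (mul_ne_zero h₁ h₂)] at this
    linear_combination this
  · have h₁ := hW i hi.le
    have h₂ := hW (i + 1) hi
    have := hs i hi
    rw [eq_div_iff (mul_ne_zero h₁ h₂)] at this
    linear_combination this
  · have key := huniq (fun i => E' i / N i) (fun i => S' i / W i) (by simp only [h0, h0'])
      (by simp only [hm, hm']) (fun i hi => by
        have h₁ := hN i hi.le
        have h₂ := hN (i + 1) hi
        simp only [← hE' i hi]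
        field_simp) (fun i hi => by
        have h₁ := hW i hi.le
        have h₂ := hW (i + 1) hi
        simp only [← hS' i hi]
        field_simp) i hi
    rw [div_eq_iff (hN i hi), div_eq_iff (hW i hi)] at key
    exact ⟨key.1.trans (mul_comm _ _), key.2.trans (mul_comm _ _)⟩

/-- The sequence `f` with its values at `0` and `m` replaced by `x` and `y`. -/
def withEnds {F : Type*} (m : ℕ) (x y : F) (f : ℕ → F) (i : ℕ) : F :=
  if i = 0 then x else if i = m then y else f i

/-- The sequence `f` with its value at `m` multiplied by `x`. -/
def scaleAt {F : Type*} [Field F] (m : ℕ) (x : F) (f : ℕ → F) (i : ℕ) : F :=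
  if i = m then f i * x else f i

theorem withEnds_zero {F : Type*} (m : ℕ) (x y : F) (f : ℕ → F) : withEnds m x y f 0 = x := rfl

theorem withEnds_succ_self {F : Type*} (m : ℕ) (x y : F) (f : ℕ → F) :
    withEnds (m + 1) x y f (m + 1) = y := by
  simp [withEnds]

theorem withEnds_of_ne {F : Type*} {m i : ℕ} (x y : F) (f : ℕ → F) (h0 : i ≠ 0) (hm : i ≠ m) :
    withEnds m x y f i = f i := by
  simp [withEnds, h0, hm]

theorem withEnds_ne_zero {F : Type*} [Field F] {m : ℕ} {x y : F} {f : ℕ → F} (hx : x ≠ 0)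
    (hy : y ≠ 0) (hf : ∀ i, 1 ≤ i → i < m → f i ≠ 0) : ∀ i ≤ m, withEnds m x y f i ≠ 0 := by
  intro i hi
  unfold withEnds
  split_ifs
  · exact hx
  · exact hy
  · exact hf i (by omega) (by omega)

theorem scaleAt_self {F : Type*} [Field F] (m : ℕ) (x : F) (f : ℕ → F) :
    scaleAt m x f m = f m * x := by
  simp [scaleAt]

theorem scaleAt_of_ne {F : Type*} [Field F] {m i : ℕ} (x : F) (f : ℕ → F) (h : i ≠ m) :
    scaleAt m x f i = f i := by
  simp [scaleAt, h]

theorem scaleAt_ne_zero {F : Type*} [Field F] {m i : ℕ} {x : F} {f : ℕ → F} (hx : x ≠ 0)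
    (hf : f i ≠ 0) : scaleAt m x f i ≠ 0 := by
  unfold scaleAt
  split_ifs
  · exact mul_ne_zero hf hx
  · exact hf

theorem prod_range_scaleAt {F : Type*} [Field F] (r : ℕ) (f : ℕ → F) :
    ∏ i ∈ Finset.range (r + 1), scaleAt (r + 1) (f (r + 2)) f (i + 1) =
      ∏ i ∈ Finset.range (r + 2), f (i + 1) := by
  rw [Finset.prod_range_succ, scaleAt_self, Finset.prod_range_succ, Finset.prod_range_succ,
    mul_assoc]
  congr 1
  refine Finset.prod_congr rfl fun i hi => scaleAt_of_ne _ _ ?_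
  have := Finset.mem_range.1 hi
  omega

theorem prod_Icc_one_eq_prod_range {F : Type*} [Field F] (m : ℕ) (f : ℕ → F) :
    ∏ i ∈ Finset.Icc 1 m, f i = ∏ i ∈ Finset.range m, f (i + 1) := by
  rw [Finset.range_eq_Ico, Finset.prod_Ico_add' f 0 m 1]
  rfl

/-- The left-hand side of `⟨2,i⟩`, written uniformly in `1 ≤ i ≤ r + 1` for `n = r + 2`. -/
def tauZeroSide {F : Type*} [Field F] (r : ℕ) (lam kap kapb W N t1 t3 : ℕ → F) (i : ℕ) : F :=
  scaleAt (r + 1) (kap (r + 2)) kapb i * withEnds (r + 1) (t3 0) (t3 (r + 1)) W (i - 1) *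
      withEnds (r + 1) (t1 0) (t1 (r + 1)) N i +
    lam i * withEnds (r + 1) (t1 0) (t1 (r + 1)) N (i - 1) *
      withEnds (r + 1) (t3 0) (t3 (r + 1)) W i

/-- The left-hand side of `⟨4,i⟩`, written uniformly in `1 ≤ i ≤ r + 1` for `n = r + 2`. -/
def tauFourSide {F : Type*} [Field F] (r : ℕ) (lam lamb kap S E t1 t3 : ℕ → F) (i : ℕ) : F :=
  kap i * withEnds (r + 1) (t1 0) (t1 (r + 1)) E (i - 1) *
      withEnds (r + 1) (t3 0) (t3 (r + 1)) S i +
    scaleAt (r + 1) (lam (r + 2)) lamb i * withEnds (r + 1) (t3 0) (t3 (r + 1)) S (i - 1) *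
      withEnds (r + 1) (t1 0) (t1 (r + 1)) E i

/-- The equations `⟨J,i⟩` with `1 ≤ i ≤ n - 1` in a form uniform in `i`. -/
theorem forall_BE_iff {F : Type*} [Field F] (r : ℕ) (hr : 2 ≤ r)
    (lam lamb kap kapb S W N E t0 t1 t2 t3 t4 : ℕ → F) (α β : F) :
    (∀ J i, 1 ≤ J → J ≤ 4 → 1 ≤ i → i ≤ r + 1 →
      BE (r + 2) lam lamb kap kapb S W N E t0 t1 t2 t3 t4 α β J i) ↔
    ∀ i < r + 1,
      (scaleAt (r + 1) (kap (r + 2)) kap (i + 1) *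
            withEnds (r + 1) (t4 0) (t4 (r + 2)) E i *
            withEnds (r + 1) (t2 0) (t2 (r + 2)) N (i + 1) -
          scaleAt (r + 1) (lam (r + 2)) lam (i + 1) *
            withEnds (r + 1) (t2 0) (t2 (r + 2)) N i *
            withEnds (r + 1) (t4 0) (t4 (r + 2)) E (i + 1) =
        α * t0 (i + 1) * withEnds (r + 1) (t1 0) (t1 (r + 2)) t1 (i + 1)) ∧
      tauZeroSide r lam kap kapb W N t1 t3 (i + 1) = β * t0 (i + 1) * t2 (i + 1) ∧
      (kapb (i + 1) * withEnds (r + 1) (t2 0) (t2 (r + 2)) W i *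
            withEnds (r + 1) (t4 0) (t4 (r + 2)) S (i + 1) -
          lamb (i + 1) * withEnds (r + 1) (t4 0) (t4 (r + 2)) S i *
            withEnds (r + 1) (t2 0) (t2 (r + 2)) W (i + 1) =
        α * t0 (i + 1) * withEnds (r + 1) (t3 0) (t3 (r + 2)) t3 (i + 1)) ∧
      tauFourSide r lam lamb kap S E t1 t3 (i + 1) = β * t0 (i + 1) * t4 (i + 1) := by
  have hends : ∀ (x y : F) (f : ℕ → F), withEnds (r + 1) x y f 1 = f 1 ∧
      withEnds (r + 1) x y f r = f r := fun x y f =>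
    ⟨withEnds_of_ne x y f (by omega) (by omega), withEnds_of_ne x y f (by omega) (by omega)⟩
  have hscale : ∀ (x : F) (f : ℕ → F), scaleAt (r + 1) x f 1 = f 1 := fun x f =>
    scaleAt_of_ne x f (by omega)
  have hr0 : r ≠ 0 := by omega
  have hsub : r + 2 - 1 = r + 1 := rfl
  have hsub' : r + 2 - 2 = r := rfl
  have hJ : ∀ P : ℕ → Prop, (∀ J, 1 ≤ J → J ≤ 4 → P J) ↔ P 1 ∧ P 2 ∧ P 3 ∧ P 4 := fun P =>
    ⟨fun h => ⟨h 1 (by omega) (by omega), h 2 (by omega) (by omega), h 3 (by omega) (by omega),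
      h 4 (by omega) (by omega)⟩, fun ⟨h₁, h₂, h₃, h₄⟩ J hJ₁ hJ₄ => by
        interval_cases J <;> assumption⟩
  have hswap : (∀ J i, 1 ≤ J → J ≤ 4 → 1 ≤ i → i ≤ r + 1 →
      BE (r + 2) lam lamb kap kapb S W N E t0 t1 t2 t3 t4 α β J i) ↔
      ∀ i < r + 1, ∀ J, 1 ≤ J → J ≤ 4 →
        BE (r + 2) lam lamb kap kapb S W N E t0 t1 t2 t3 t4 α β J (i + 1) := by
    refine ⟨fun h i hi J hJ₁ hJ₄ => h J (i + 1) hJ₁ hJ₄ (by omega) (by omega),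
      fun h J i hJ₁ hJ₄ hi₁ hi => ?_⟩
    obtain ⟨i, rfl⟩ := Nat.exists_eq_add_of_le' hi₁
    exact h i (by omega) J hJ₁ hJ₄
  rw [hswap]
  refine forall₂_congr fun i hi => ?_
  rw [hJ]
  unfold tauZeroSide tauFourSide
  rw [Nat.add_sub_cancel]
  rcases Nat.eq_zero_or_pos i with rfl | hi₀
  · simp only [BE, zero_add, withEnds_zero, (hends _ _ _).1, hscale, one_ne_zero, if_true, if_false,
      OfNat.ofNat_ne_one, Nat.reduceEqDiff]
    refine and_congr ?_ (and_congr ?_ (and_congr ?_ ?_)) <;>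
      exact ⟨fun h => by linear_combination h, fun h => by linear_combination h⟩
  · rcases eq_or_ne i r with rfl | hir
    · simp only [BE, withEnds_succ_self, (hends _ _ _).2, scaleAt_self, if_true,
        if_false, Nat.succ_ne_zero, hr0, Nat.add_eq_right, hsub, hsub', OfNat.ofNat_ne_one,
        Nat.reduceEqDiff]
      refine and_congr ?_ (and_congr ?_ (and_congr ?_ ?_)) <;>
        exact ⟨fun h => by linear_combination h, fun h => by linear_combination h⟩
    · have hmid : ∀ (x y : F) (f : ℕ → F), withEnds (r + 1) x y f (i + 1) = f (i + 1) ∧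
          withEnds (r + 1) x y f i = f i := fun x y f =>
        ⟨withEnds_of_ne x y f (by omega) (by omega), withEnds_of_ne x y f (by omega) (by omega)⟩
      have hmid' : ∀ (x : F) (f : ℕ → F), scaleAt (r + 1) x f (i + 1) = f (i + 1) := fun x f =>
        scaleAt_of_ne x f (by omega)
      have hi₁ : i + 1 ≠ 1 := by omega
      have hi₂ : i + 1 ≠ r + 1 := by omega
      have hi₃ : i + 1 ≠ r + 2 := by omega
      simp only [BE, (hmid _ _ _).1, (hmid _ _ _).2, hmid', hi₁, hi₂, hi₃, hsub, if_true, if_false,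
        Nat.succ_ne_zero, Nat.add_sub_cancel, OfNat.ofNat_ne_one, Nat.reduceEqDiff]

theorem stmt0 {F : Type*} [Field F] (n : ℕ) (hn : 4 ≤ n)
    (lam lamb kap kapb : ℕ → F) (α β : F)
    (hlam : ∀ i, 1 ≤ i → i ≤ n → lam i ≠ 0)
    (hlamb : ∀ i, 1 ≤ i → i ≤ n - 1 → lamb i ≠ 0)
    (hkap : ∀ i, 1 ≤ i → i ≤ n → kap i ≠ 0)
    (hkapb : ∀ i, 1 ≤ i → i ≤ n - 1 → kapb i ≠ 0)
    (l k : F)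
    (hl : l = (∏ i ∈ Finset.Icc 1 n, lam i) * ∏ i ∈ Finset.Icc 1 (n - 1), lamb i)
    (hk : k = (∏ i ∈ Finset.Icc 1 n, kap i) * ∏ i ∈ Finset.Icc 1 (n - 1), kapb i)
    (hlk : l * k * (l - k) ≠ 0)
    (hα : α ≠ 0) (hβ : β ≠ 0)
    (W N t1 t2 t3 : ℕ → F)
    (hW : ∀ i, 1 ≤ i → i ≤ n - 2 → W i ≠ 0)
    (hN : ∀ i, 1 ≤ i → i ≤ n - 2 → N i ≠ 0)
    (ht1 : ∀ i ≤ n, t1 i ≠ 0) (ht2 : ∀ i ≤ n, t2 i ≠ 0) (ht3 : ∀ i ≤ n, t3 i ≠ 0)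
    -- genericity: the values τ⁰_1,…,τ⁰_{n-1} determined by ⟨2,1⟩–⟨2,n-1⟩ are nonzero
    (hg1 : kapb 1 * N 1 * t3 0 + lam 1 * W 1 * t1 0 ≠ 0)
    (hgi : ∀ i, 2 ≤ i → i ≤ n - 2 → kapb i * W (i - 1) * N i + lam i * N (i - 1) * W i ≠ 0)
    (hgn : kap n * kapb (n - 1) * W (n - 2) * t1 (n - 1) + lam (n - 1) * N (n - 2) * t3 (n - 1) ≠ 0) :
    ∃ S E t0 t4 : ℕ → F,
      (∀ J i, 1 ≤ J → J ≤ 4 → 1 ≤ i → i ≤ n - 1 →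
        BE n lam lamb kap kapb S W N E t0 t1 t2 t3 t4 α β J i) ∧
      ∀ S' E' t0' t4' : ℕ → F,
        (∀ J i, 1 ≤ J → J ≤ 4 → 1 ≤ i → i ≤ n - 1 →
          BE n lam lamb kap kapb S' W N E' t0' t1 t2 t3 t4' α β J i) →
        (∀ i, 1 ≤ i → i ≤ n - 2 → S' i = S i) ∧
        (∀ i, 1 ≤ i → i ≤ n - 2 → E' i = E i) ∧
        (∀ i, 1 ≤ i → i ≤ n - 1 → t0' i = t0 i) ∧
        (∀ i ≤ n, t4' i = t4 i) := by
  obtain ⟨r, rfl⟩ := Nat.exists_eq_add_of_le' (show 2 ≤ n by omega)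
  have hr : 2 ≤ r := by omega
  simp only [show r + 2 - 1 = r + 1 from rfl, show r + 2 - 2 = r from rfl] at *
  have hA : ∀ i < r + 1, tauZeroSide r lam kap kapb W N t1 t3 (i + 1) ≠ 0 := by
    intro i hi
    unfold tauZeroSide
    rw [Nat.add_sub_cancel]
    rcases Nat.eq_zero_or_pos i with rfl | hi₀
    · rw [withEnds_zero, withEnds_zero, withEnds_of_ne _ _ _ (by omega) (by omega),
        withEnds_of_ne _ _ _ (by omega) (by omega), scaleAt_of_ne _ _ (by omega)]
      convert hg1 using 1
      ring
    · rw [withEnds_of_ne (i := i) _ _ _ (by omega) (by omega),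
        withEnds_of_ne (i := i) _ _ _ (by omega) (by omega)]
      rcases eq_or_ne i r with rfl | hir
      · rw [withEnds_succ_self, withEnds_succ_self, scaleAt_self]
        convert hgn using 1
        ring
      · rw [withEnds_of_ne _ _ _ (by omega) (by omega), withEnds_of_ne _ _ _ (by omega) (by omega),
          scaleAt_of_ne _ _ (by omega)]
        exact hgi (i + 1) (by omega) (by omega)
  have hcyc : (∏ i ∈ Finset.range (r + 1), scaleAt (r + 1) (kap (r + 2)) kap (i + 1)) *
        ∏ i ∈ Finset.range (r + 1), kapb (i + 1) ≠
      (∏ i ∈ Finset.range (r + 1), scaleAt (r + 1) (lam (r + 2)) lam (i + 1)) *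
        ∏ i ∈ Finset.range (r + 1), lamb (i + 1) := by
    rw [prod_range_scaleAt, prod_range_scaleAt]
    simp only [prod_Icc_one_eq_prod_range] at hl hk
    rw [← hl, ← hk]
    exact (sub_ne_zero.1 (right_ne_zero_of_mul hlk)).symm
  let t0 : ℕ → F := fun i => tauZeroSide r lam kap kapb W N t1 t3 i / (β * t2 i)
  have ht0 : ∀ i < r + 1, t0 (i + 1) ≠ 0 := fun i hi =>
    div_ne_zero (hA i hi) (mul_ne_zero hβ (ht2 _ (by omega)))
  obtain ⟨E, S, ⟨h0, hm, hE, hS⟩, huniq⟩ := exists_unique_bilinear_cycle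
    (fun i => scaleAt (r + 1) (kap (r + 2)) kap (i + 1))
    (fun i => scaleAt (r + 1) (lam (r + 2)) lam (i + 1))
    (fun i => α * t0 (i + 1) * withEnds (r + 1) (t1 0) (t1 (r + 2)) t1 (i + 1))
    (fun i => kapb (i + 1)) (fun i => lamb (i + 1))
    (fun i => α * t0 (i + 1) * withEnds (r + 1) (t3 0) (t3 (r + 2)) t3 (i + 1))
    (withEnds (r + 1) (t2 0) (t2 (r + 2)) N) (withEnds (r + 1) (t2 0) (t2 (r + 2)) W) (r + 1)
    (fun i hi => scaleAt_ne_zero (hlam _ (by omega) le_rfl) (hlam _ (by omega) (by omega)))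
    (fun i hi => hkapb _ (by omega) (by omega))
    (withEnds_ne_zero (ht2 _ (by omega)) (ht2 _ le_rfl) fun i hi hi' => hN i hi (by omega))
    (withEnds_ne_zero (ht2 _ (by omega)) (ht2 _ le_rfl) fun i hi hi' => hW i hi (by omega))
    rfl (by rw [withEnds_succ_self, withEnds_succ_self]) hcyc
  let t4 : ℕ → F := withEnds (r + 2) (E 0) (E (r + 1)) fun i =>
    tauFourSide r lam lamb kap S E t1 t3 i / (β * t0 i)
  have ht4 : ∀ i < r + 1,
      t4 (i + 1) = tauFourSide r lam lamb kap S E t1 t3 (i + 1) / (β * t0 (i + 1)) :=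
    fun i hi => withEnds_of_ne _ _ _ (by omega) (by omega)
  have ht4n : t4 (r + 2) = E (r + 1) := withEnds_succ_self _ _ _ _
  refine ⟨S, E, t0, t4, (forall_BE_iff r hr ..).2 fun i hi => ?_, fun S' E' t0' t4' H => ?_⟩
  · have hEE : withEnds (r + 1) (t4 0) (t4 (r + 2)) E = E := by
      funext j
      unfold withEnds
      split_ifs with h₁ h₂
      · rw [h₁]; rfl
      · rw [h₂, ht4n]
      · rfl
    have hSS : withEnds (r + 1) (t4 0) (t4 (r + 2)) S = S := by
      funext j
      unfold withEnds
      split_ifs with h₁ h₂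
      · rw [h₁, ← h0]; rfl
      · rw [h₂, ht4n, hm]
      · rfl
    rw [hEE, hSS]
    refine ⟨hE i hi, ?_, hS i hi, ?_⟩
    · have := ht2 (i + 1) (by omega)
      simp only [t0]
      field_simp
    · have := ht0 i hi
      rw [ht4 i hi]
      field_simp
  · rw [forall_BE_iff r hr] at H
    have ht0' : ∀ i < r + 1, t0' (i + 1) = t0 (i + 1) := by
      intro i hi
      have := ht2 (i + 1) (by omega)
      rw [eq_div_iff (mul_ne_zero hβ this)]
      linear_combination -(H i hi).2.1
    have key := huniq (withEnds (r + 1) (t4' 0) (t4' (r + 2)) E')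
      (withEnds (r + 1) (t4' 0) (t4' (r + 2)) S') rfl
      (by rw [withEnds_succ_self, withEnds_succ_self])
      (fun i hi => by rw [(H i hi).1, ht0' i hi]) (fun i hi => by rw [(H i hi).2.2.1, ht0' i hi])
    have hE' : ∀ i, 1 ≤ i → i ≤ r → E' i = E i := fun i hi hi' => by
      rw [← (key i (by omega)).1, withEnds_of_ne _ _ _ (by omega) (by omega)]
    have hS' : ∀ i, 1 ≤ i → i ≤ r → S' i = S i := fun i hi hi' => by
      rw [← (key i (by omega)).2, withEnds_of_ne _ _ _ (by omega) (by omega)]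
    have hcongr : ∀ (x y : F) (f g : ℕ → F), (∀ i, 1 ≤ i → i ≤ r → f i = g i) →
        ∀ i ≤ r + 1, withEnds (r + 1) x y f i = withEnds (r + 1) x y g i := by
      intro x y f g hfg i hi
      unfold withEnds
      split_ifs
      · rfl
      · rfl
      · exact hfg i (by omega) (by omega)
    refine ⟨hS', hE', fun i hi hi' => ?_, fun i hi => ?_⟩
    · obtain ⟨i, rfl⟩ := Nat.exists_eq_add_of_le' hi
      exact ht0' i (by omega)
    · rcases Nat.eq_zero_or_pos i with rfl | hi₀
      · exact (key 0 (by omega)).1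
      · rcases eq_or_ne i (r + 2) with rfl | hir
        · rw [ht4n, ← (key (r + 1) le_rfl).1, withEnds_succ_self]
        · obtain ⟨i, rfl⟩ := Nat.exists_eq_add_of_le' hi₀
          have hi' : i < r + 1 := by omega
          have h₄ := (H i hi').2.2.2
          have hside : tauFourSide r lam lamb kap S' E' t1 t3 (i + 1) =
              tauFourSide r lam lamb kap S E t1 t3 (i + 1) := by
            unfold tauFourSide
            rw [Nat.add_sub_cancel, hcongr _ _ _ _ hE' i (by omega), hcongr _ _ _ _ hE' (i + 1) hi',
              hcongr _ _ _ _ hS' i (by omega), hcongr _ _ _ _ hS' (i + 1) hi']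
          rw [ht4 i hi', eq_div_iff (mul_ne_zero hβ (ht0 i hi')), ← hside, h₄, ht0' i hi']
          ring
end

section
/- Suppose S_i, W_i, N_i, E_i (1 ≤ i ≤ n−2) and τJ_i (0 ≤ J ≤ 4, 0 ≤ i ≤ n) are all nonzero and satisfy the equations ⟨J,i⟩ for 1 ≤ J ≤ 4 and 1 ≤ i ≤ n−1. Then α·λ̄_1·κ̄_1·τ3_0·τ1_1 + β·λ_1·κ̄_1·τ2_0·τ4_1 − α·λ_1·κ_1·τ1_0·τ3_1 − β·λ̄_1·κ_1·τ4_0·τ2_1 = 0. -/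
theorem stmt1 {F : Type*} [Field F] (n : ℕ) (hn : 4 ≤ n)
    (lam lamb kap kapb : ℕ → F) (α β : F)
    (hlam : ∀ i, 1 ≤ i → i ≤ n → lam i ≠ 0)
    (hlamb : ∀ i, 1 ≤ i → i ≤ n - 1 → lamb i ≠ 0)
    (hkap : ∀ i, 1 ≤ i → i ≤ n → kap i ≠ 0)
    (hkapb : ∀ i, 1 ≤ i → i ≤ n - 1 → kapb i ≠ 0)
    (l k : F)
    (hl : l = (∏ i ∈ Finset.Icc 1 n, lam i) * ∏ i ∈ Finset.Icc 1 (n - 1), lamb i)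
    (hk : k = (∏ i ∈ Finset.Icc 1 n, kap i) * ∏ i ∈ Finset.Icc 1 (n - 1), kapb i)
    (hlk : l * k * (l - k) ≠ 0)
    (hα : α ≠ 0) (hβ : β ≠ 0)
    (S W N E t0 t1 t2 t3 t4 : ℕ → F)
    (hS : ∀ i, 1 ≤ i → i ≤ n - 2 → S i ≠ 0)
    (hW : ∀ i, 1 ≤ i → i ≤ n - 2 → W i ≠ 0)
    (hN : ∀ i, 1 ≤ i → i ≤ n - 2 → N i ≠ 0)
    (hE : ∀ i, 1 ≤ i → i ≤ n - 2 → E i ≠ 0)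
    (ht0 : ∀ i ≤ n, t0 i ≠ 0) (ht1 : ∀ i ≤ n, t1 i ≠ 0) (ht2 : ∀ i ≤ n, t2 i ≠ 0)
    (ht3 : ∀ i ≤ n, t3 i ≠ 0) (ht4 : ∀ i ≤ n, t4 i ≠ 0)
    (heqs : ∀ J i, 1 ≤ J → J ≤ 4 → 1 ≤ i → i ≤ n - 1 →
      BE n lam lamb kap kapb S W N E t0 t1 t2 t3 t4 α β J i) :
    α * lamb 1 * kapb 1 * t3 0 * t1 1 + β * lam 1 * kapb 1 * t2 0 * t4 1
      - α * lam 1 * kap 1 * t1 0 * t3 1 - β * lamb 1 * kap 1 * t4 0 * t2 1 = 0 := by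
  have h1 := heqs 1 1 le_rfl (by omega) le_rfl (by omega)
  have h2 := heqs 2 1 (by omega) (by omega) le_rfl (by omega)
  have h3 := heqs 3 1 (by omega) (by omega) le_rfl (by omega)
  have h4 := heqs 4 1 (by omega) le_rfl le_rfl (by omega)
  simp only [BE, OfNat.ofNat_ne_one, one_ne_zero, if_true, if_false, Nat.reduceEqDiff] at h1 h2 h3 h4
  refine (mul_eq_zero.mp ?_).resolve_left (ht0 1 (by omega))
  linear_combination -lamb 1 * kapb 1 * t3 0 * h1 - lam 1 * kapb 1 * t2 0 * h4
    + lam 1 * kap 1 * t1 0 * h3 + lamb 1 * kap 1 * t4 0 * h2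
end

section
/- Suppose S_i, W_i, N_i, E_i (1 ≤ i ≤ n−2) and τJ_i (0 ≤ J ≤ 4, 0 ≤ i ≤ n) are all nonzero and satisfy the equations ⟨J,i⟩ for 1 ≤ J ≤ 4 and 1 ≤ i ≤ n−1. Then α·τ3_{n−1}·τ1_n + β·λ_n·τ4_n·τ2_{n−1} − α·λ_n·κ_n·τ1_{n−1}·τ3_n − β·κ_n·τ2_n·τ4_{n−1} = 0. -/
theorem stmt2 {F : Type*} [Field F] (n : ℕ) (hn : 4 ≤ n)
    (lam lamb kap kapb : ℕ → F) (α β : F)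
    (hlam : ∀ i, 1 ≤ i → i ≤ n → lam i ≠ 0)
    (hlamb : ∀ i, 1 ≤ i → i ≤ n - 1 → lamb i ≠ 0)
    (hkap : ∀ i, 1 ≤ i → i ≤ n → kap i ≠ 0)
    (hkapb : ∀ i, 1 ≤ i → i ≤ n - 1 → kapb i ≠ 0)
    (l k : F)
    (hl : l = (∏ i ∈ Finset.Icc 1 n, lam i) * ∏ i ∈ Finset.Icc 1 (n - 1), lamb i)
    (hk : k = (∏ i ∈ Finset.Icc 1 n, kap i) * ∏ i ∈ Finset.Icc 1 (n - 1), kapb i)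
    (hlk : l * k * (l - k) ≠ 0)
    (hα : α ≠ 0) (hβ : β ≠ 0)
    (S W N E t0 t1 t2 t3 t4 : ℕ → F)
    (hS : ∀ i, 1 ≤ i → i ≤ n - 2 → S i ≠ 0)
    (hW : ∀ i, 1 ≤ i → i ≤ n - 2 → W i ≠ 0)
    (hN : ∀ i, 1 ≤ i → i ≤ n - 2 → N i ≠ 0)
    (hE : ∀ i, 1 ≤ i → i ≤ n - 2 → E i ≠ 0)
    (ht0 : ∀ i ≤ n, t0 i ≠ 0) (ht1 : ∀ i ≤ n, t1 i ≠ 0) (ht2 : ∀ i ≤ n, t2 i ≠ 0)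
    (ht3 : ∀ i ≤ n, t3 i ≠ 0) (ht4 : ∀ i ≤ n, t4 i ≠ 0)
    (heqs : ∀ J i, 1 ≤ J → J ≤ 4 → 1 ≤ i → i ≤ n - 1 →
      BE n lam lamb kap kapb S W N E t0 t1 t2 t3 t4 α β J i) :
    α * t3 (n - 1) * t1 n + β * lam n * t4 n * t2 (n - 1)
      - α * lam n * kap n * t1 (n - 1) * t3 n - β * kap n * t2 n * t4 (n - 1) = 0 := by
  have h0 : n - 1 ≠ 0 := by omega
  have h1 : n - 1 ≠ 1 := by omega
  have e1 := heqs 1 (n - 1) (by norm_num) (by norm_num) (by omega) le_rfl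
  have e2 := heqs 2 (n - 1) (by norm_num) (by norm_num) (by omega) le_rfl
  have e3 := heqs 3 (n - 1) (by norm_num) (by norm_num) (by omega) le_rfl
  have e4 := heqs 4 (n - 1) (by norm_num) (by norm_num) (by omega) le_rfl
  simp only [BE, h0, h1, if_true, if_false, OfNat.ofNat_ne_one, Nat.reduceEqDiff] at e1 e2 e3 e4
  refine (mul_eq_zero.mp ?_).resolve_left (ht0 (n - 1) (Nat.sub_le n 1))
  linear_combination -t3 (n - 1) * e1 - lam n * t4 n * e2
    + lam n * kap n * t1 (n - 1) * e3 + kap n * t2 n * e4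
end

section
/- Suppose S_i, W_i, N_i, E_i (1 ≤ i ≤ n−2), τJ_i (1 ≤ J ≤ 4, 0 ≤ i ≤ n) and τ0_i (1 ≤ i ≤ n−1) are all nonzero and satisfy the equations ⟨J,i⟩ for 1 ≤ J ≤ 4 and 1 ≤ i ≤ n−1. Then there exists a unique element τ0_0 ∈ F such that the four equations ⟨1,0⟩, ⟨2,0⟩, ⟨3,0⟩ and ⟨4,0⟩ all hold. -/
theorem stmt3 {F : Type*} [Field F] (n : ℕ) (hn : 4 ≤ n)
    (lam lamb kap kapb : ℕ → F) (α β : F)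
    (hlam : ∀ i, 1 ≤ i → i ≤ n → lam i ≠ 0)
    (hlamb : ∀ i, 1 ≤ i → i ≤ n - 1 → lamb i ≠ 0)
    (hkap : ∀ i, 1 ≤ i → i ≤ n → kap i ≠ 0)
    (hkapb : ∀ i, 1 ≤ i → i ≤ n - 1 → kapb i ≠ 0)
    (l k : F)
    (hl : l = (∏ i ∈ Finset.Icc 1 n, lam i) * ∏ i ∈ Finset.Icc 1 (n - 1), lamb i)
    (hk : k = (∏ i ∈ Finset.Icc 1 n, kap i) * ∏ i ∈ Finset.Icc 1 (n - 1), kapb i)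
    (hlk : l * k * (l - k) ≠ 0)
    (hα : α ≠ 0) (hβ : β ≠ 0)
    (S W N E t0 t1 t2 t3 t4 : ℕ → F)
    (hS : ∀ i, 1 ≤ i → i ≤ n - 2 → S i ≠ 0)
    (hW : ∀ i, 1 ≤ i → i ≤ n - 2 → W i ≠ 0)
    (hN : ∀ i, 1 ≤ i → i ≤ n - 2 → N i ≠ 0)
    (hE : ∀ i, 1 ≤ i → i ≤ n - 2 → E i ≠ 0)
    (ht1 : ∀ i ≤ n, t1 i ≠ 0) (ht2 : ∀ i ≤ n, t2 i ≠ 0)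
    (ht3 : ∀ i ≤ n, t3 i ≠ 0) (ht4 : ∀ i ≤ n, t4 i ≠ 0)
    (ht0 : ∀ i, 1 ≤ i → i ≤ n - 1 → t0 i ≠ 0)
    (heqs : ∀ J i, 1 ≤ J → J ≤ 4 → 1 ≤ i → i ≤ n - 1 →
      BE n lam lamb kap kapb S W N E t0 t1 t2 t3 t4 α β J i) :
    ∃! t : F,
      kapb 1 * N 1 * t4 1 - lamb 1 * E 1 * t2 1 = α * t * t1 0 ∧
      kap 1 * N 1 * t3 1 + lamb 1 * W 1 * t1 1 = β * t * t2 0 ∧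
      kap 1 * S 1 * t2 1 - lam 1 * W 1 * t4 1 = α * t * t3 0 ∧
      kapb 1 * S 1 * t1 1 + lam 1 * E 1 * t3 1 = β * t * t4 0 := by
  have h1 := heqs 1 1 (by norm_num) (by norm_num) le_rfl (by omega)
  have h2 := heqs 2 1 (by norm_num) (by norm_num) le_rfl (by omega)
  have h3 := heqs 3 1 (by norm_num) (by norm_num) le_rfl (by omega)
  have h4 := heqs 4 1 (by norm_num) (by norm_num) le_rfl (by omega)
  simp only [BE, one_ne_zero, if_true, if_false, OfNat.ofNat_ne_one, Nat.reduceEqDiff] at h1 h2 h3 h4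
  have h0 : t0 1 ≠ 0 := ht0 1 le_rfl (by omega)
  have h10 : t1 0 ≠ 0 := ht1 0 (Nat.zero_le n)
  refine ⟨(kap 1 * kapb 1 * N 1 * S 1 - lam 1 * lamb 1 * E 1 * W 1) / (α * β * t0 1),
    ⟨?_, ?_, ?_, ?_⟩, ?_⟩
  · field_simp
    linear_combination (-(kapb 1 * N 1)) * h4 + lamb 1 * E 1 * h2
  · field_simp
    linear_combination (-(kap 1 * N 1)) * h3 - lamb 1 * W 1 * h1
  · field_simp
    linear_combination (-(kap 1 * S 1)) * h2 + lam 1 * W 1 * h4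
  · field_simp
    linear_combination (-(kapb 1 * S 1)) * h1 - lam 1 * E 1 * h3
  · rintro t ⟨ht, -⟩
    rw [eq_div_iff (mul_ne_zero (mul_ne_zero hα hβ) h0)]
    apply mul_right_cancel₀ h10
    linear_combination (-(β * t0 1)) * ht - kapb 1 * N 1 * h4 + lamb 1 * E 1 * h2
end

section
/- Suppose S_i, W_i, N_i, E_i (1 ≤ i ≤ n−2), τJ_i (1 ≤ J ≤ 4, 0 ≤ i ≤ n) and τ0_i (1 ≤ i ≤ n−1) are all nonzero and satisfy the equations ⟨J,i⟩ for 1 ≤ J ≤ 4 and 1 ≤ i ≤ n−1. Then there exists a unique element τ0_n ∈ F such that the four equations ⟨1,n⟩, ⟨2,n⟩, ⟨3,n⟩ and ⟨4,n⟩ all hold. -/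
theorem stmt4 {F : Type*} [Field F] (n : ℕ) (hn : 4 ≤ n)
    (lam lamb kap kapb : ℕ → F) (α β : F)
    (hlam : ∀ i, 1 ≤ i → i ≤ n → lam i ≠ 0)
    (hlamb : ∀ i, 1 ≤ i → i ≤ n - 1 → lamb i ≠ 0)
    (hkap : ∀ i, 1 ≤ i → i ≤ n → kap i ≠ 0)
    (hkapb : ∀ i, 1 ≤ i → i ≤ n - 1 → kapb i ≠ 0)
    (l k : F)
    (hl : l = (∏ i ∈ Finset.Icc 1 n, lam i) * ∏ i ∈ Finset.Icc 1 (n - 1), lamb i)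
    (hk : k = (∏ i ∈ Finset.Icc 1 n, kap i) * ∏ i ∈ Finset.Icc 1 (n - 1), kapb i)
    (hlk : l * k * (l - k) ≠ 0)
    (hα : α ≠ 0) (hβ : β ≠ 0)
    (S W N E t0 t1 t2 t3 t4 : ℕ → F)
    (hS : ∀ i, 1 ≤ i → i ≤ n - 2 → S i ≠ 0)
    (hW : ∀ i, 1 ≤ i → i ≤ n - 2 → W i ≠ 0)
    (hN : ∀ i, 1 ≤ i → i ≤ n - 2 → N i ≠ 0)
    (hE : ∀ i, 1 ≤ i → i ≤ n - 2 → E i ≠ 0)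
    (ht1 : ∀ i ≤ n, t1 i ≠ 0) (ht2 : ∀ i ≤ n, t2 i ≠ 0)
    (ht3 : ∀ i ≤ n, t3 i ≠ 0) (ht4 : ∀ i ≤ n, t4 i ≠ 0)
    (ht0 : ∀ i, 1 ≤ i → i ≤ n - 1 → t0 i ≠ 0)
    (heqs : ∀ J i, 1 ≤ J → J ≤ 4 → 1 ≤ i → i ≤ n - 1 →
      BE n lam lamb kap kapb S W N E t0 t1 t2 t3 t4 α β J i) :
    ∃! t : F,
      kap (n - 1) * E (n - 2) * t2 (n - 1) - lam (n - 1) * N (n - 2) * t4 (n - 1)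
        = α * t * t1 (n - 1) ∧
      kapb (n - 1) * W (n - 2) * t1 n + lam (n - 1) * lam n * N (n - 2) * t3 n
        = β * t * t2 n ∧
      kap n * kapb (n - 1) * W (n - 2) * t4 (n - 1) - lam n * lamb (n - 1) * S (n - 2) * t2 (n - 1)
        = α * t * t3 (n - 1) ∧
      kap (n - 1) * kap n * E (n - 2) * t3 n + lamb (n - 1) * S (n - 2) * t1 n
        = β * t * t4 n := by
  have hc : t0 (n - 1) ≠ 0 := ht0 _ (by omega) le_rfl
  have hp1 : t1 (n - 1) ≠ 0 := ht1 _ (by omega)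
  have h1 := heqs 1 (n - 1) (by omega) (by omega) (by omega) le_rfl
  have h2 := heqs 2 (n - 1) (by omega) (by omega) (by omega) le_rfl
  have h3 := heqs 3 (n - 1) (by omega) (by omega) (by omega) le_rfl
  have h4 := heqs 4 (n - 1) (by omega) (by omega) (by omega) le_rfl
  have hi0 : n - 1 ≠ 0 := by omega
  have hi1 : n - 1 ≠ 1 := by omega
  simp only [BE, hi0, hi1, OfNat.ofNat_ne_one, OfNat.one_ne_ofNat, Nat.reduceEqDiff,
    if_true, if_false] at h1 h2 h3 h4
  refine ⟨(kap (n - 1) * kap n * kapb (n - 1) * E (n - 2) * W (n - 2)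
    - lam (n - 1) * lam n * lamb (n - 1) * N (n - 2) * S (n - 2)) / (α * β * t0 (n - 1)),
    ⟨?_, ?_, ?_, ?_⟩, ?_⟩
  · field_simp
    linear_combination lam (n - 1) * N (n - 2) * h4 - kap (n - 1) * E (n - 2) * h2
  · field_simp
    linear_combination -kapb (n - 1) * W (n - 2) * h1 - lam (n - 1) * lam n * N (n - 2) * h3
  · field_simp
    linear_combination lam n * lamb (n - 1) * S (n - 2) * h2
      - kap n * kapb (n - 1) * W (n - 2) * h4
  · field_simp
    linear_combination -kap (n - 1) * kap n * E (n - 2) * h3 - lamb (n - 1) * S (n - 2) * h1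
  · rintro t ⟨ht, -⟩
    field_simp
    apply mul_right_cancel₀ hp1
    linear_combination -β * t0 (n - 1) * ht - kap (n - 1) * E (n - 2) * h2
      + lam (n - 1) * N (n - 2) * h4
end

section
/- (Invariance under σ_n.) Define the involution σ_n on the data by λ_{n−1} ↦ λ_{n−1}·λ_n, λ̄_{n−1} ↦ λ̄_{n−1}·λ_n, λ_n ↦ 1/λ_n, κ_{n−1} ↦ κ_{n−1}·κ_n, κ̄_{n−1} ↦ κ̄_{n−1}·κ_n, κ_n ↦ 1/κ_n, and τJ_{n−1} ↔ τJ_n for every J with 0 ≤ J ≤ 4, leaving all other parameters and tau functions unchanged. If the data satisfies all the bilinear equations ⟨J,i⟩ (1 ≤ J ≤ 4, 0 ≤ i ≤ n), then so does the σ_n-transformed data. -/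
theorem stmt7 {F : Type*} [Field F] (n : ℕ) (hn : 4 ≤ n)
    (lam lamb kap kapb : ℕ → F) (α β : F)
    (hlam : ∀ i, 1 ≤ i → i ≤ n → lam i ≠ 0)
    (hlamb : ∀ i, 1 ≤ i → i ≤ n - 1 → lamb i ≠ 0)
    (hkap : ∀ i, 1 ≤ i → i ≤ n → kap i ≠ 0)
    (hkapb : ∀ i, 1 ≤ i → i ≤ n - 1 → kapb i ≠ 0)
    (l k : F)
    (hl : l = (∏ i ∈ Finset.Icc 1 n, lam i) * ∏ i ∈ Finset.Icc 1 (n - 1), lamb i)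
    (hk : k = (∏ i ∈ Finset.Icc 1 n, kap i) * ∏ i ∈ Finset.Icc 1 (n - 1), kapb i)
    (hlk : l * k * (l - k) ≠ 0)
    (hα : α ≠ 0) (hβ : β ≠ 0)
    (S W N E t0 t1 t2 t3 t4 : ℕ → F)
    (heqs : ∀ J i, 1 ≤ J → J ≤ 4 → i ≤ n →
      BE n lam lamb kap kapb S W N E t0 t1 t2 t3 t4 α β J i) :
    ∀ J i, 1 ≤ J → J ≤ 4 → i ≤ n →
      BE n
        (fun i => if i = n - 1 then lam (n - 1) * lam n else if i = n then (lam n)⁻¹ else lam i)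
        (fun i => if i = n - 1 then lamb (n - 1) * lam n else lamb i)
        (fun i => if i = n - 1 then kap (n - 1) * kap n else if i = n then (kap n)⁻¹ else kap i)
        (fun i => if i = n - 1 then kapb (n - 1) * kap n else kapb i)
        S W N E
        (fun i => if i = n - 1 then t0 n else if i = n then t0 (n - 1) else t0 i)
        (fun i => if i = n - 1 then t1 n else if i = n then t1 (n - 1) else t1 i)
        (fun i => if i = n - 1 then t2 n else if i = n then t2 (n - 1) else t2 i)
        (fun i => if i = n - 1 then t3 n else if i = n then t3 (n - 1) else t3 i)
        (fun i => if i = n - 1 then t4 n else if i = n then t4 (n - 1) else t4 i)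
        α β J i := by
  intro J i hJ1 hJ4 hi
  have hln : lam n ≠ 0 := hlam n (by omega) le_rfl
  have hkn : kap n ≠ 0 := hkap n (by omega) le_rfl
  have h0 : 0 ≠ n - 1 := by omega
  have h0n : 0 ≠ n := by omega
  have h1 : 1 ≠ n - 1 := by omega
  have h1n : 1 ≠ n := by omega
  have hn0 : n - 1 ≠ 0 := h0.symm
  have hn1 : n - 1 ≠ 1 := h1.symm
  have hnn : n ≠ n - 1 := by omega
  have h := heqs J i hJ1 hJ4 hi
  have hpred := heqs J (n - 1) hJ1 hJ4 (by omega)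
  have hlast := heqs J n hJ1 hJ4 le_rfl
  by_cases hi_pred : i = n - 1
  · subst hi_pred
    clear h hpred
    interval_cases J <;>
      simp [BE, hn0, hn1, hnn, h0n.symm, h1n.symm] at hlast ⊢ <;>
      rw [← hlast] <;> field_simp
  by_cases hi_last : i = n
  · subst hi_last
    clear h hlast
    interval_cases J <;>
      simp [BE, hn0, hn1, hnn, h0n.symm, h1n.symm] at hpred ⊢ <;>
      rw [← hpred] <;> field_simp
  clear hpred hlast
  by_cases hi0 : i = 0
  · subst hi0
    interval_cases J <;> simpa [BE, h0, h0n, h1, h1n] using h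
  by_cases hi1 : i = 1
  · subst hi1
    interval_cases J <;> simpa [BE, h0, h0n, h1, h1n] using h
  interval_cases J <;> simpa [BE, hi0, hi1, hi_pred, hi_last] using h
end

section
/- Let z, μ ∈ B satisfy ℓ(z) = ℓ(μ)^{−1}, and fix an array τ = (τ_0,…,τ_n) of nonzero elements of F. Then the solutions (C, τ′) (with all entries of C = (C_1,…,C_{n−2}) and τ′ = (τ′_0,…,τ′_n) nonzero) of the equation [μ;τ,C,τ′] = z form a one-parameter family: for every nonzero c ∈ F there exists exactly one such solution with τ′_0 = c. The analogous statement holds with the roles of τ and τ′ interchanged (fixing τ′ and solving for (C, τ)). -/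
/-- The level `ℓ(x)` of an element of `B`, represented by the pair of families
`x = (x_1,…,x_n)` and `xb = (x̄_1,…,x̄_{n-1})`. -/
def lev {F : Type*} [Field F] (n : ℕ) (x xb : ℕ → F) : F :=
  (∏ i ∈ Finset.Icc 1 n, x i) * ∏ i ∈ Finset.Icc 1 (n - 1), xb i

/-- The functions `V_0, V_1, …, V_{n-1}` of the `D^(1)_n` tropical `R`. -/
def Vf {F : Type*} [Field F] (n : ℕ) (x xb y yb : ℕ → F) : ℕ → F
  | 0 =>
      lev n x xb * (y 1 / yb 1)
      + lev n x xb *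
          ∑ m ∈ Finset.Icc 2 (n - 1), (∏ i ∈ Finset.Icc 1 (m - 1), y i / x i) * (1 + y m / yb m)
      + x n * y n * ∏ i ∈ Finset.Icc 1 (n - 1), xb i * y i
      + lev n y yb * (xb 1 / x 1)
      + lev n y yb *
          ∑ m ∈ Finset.Icc 2 (n - 1), (∏ i ∈ Finset.Icc 1 (m - 1), xb i / yb i) * (1 + xb m / x m)
      + ∏ i ∈ Finset.Icc 1 (n - 1), xb i * y i
  | (i + 1) =>
      if i + 1 = n - 1 then
        (yb (i + 1) / y n) * (y n * Vf n x xb y yb i / xb (i + 1)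
          + (lev n x xb - lev n y yb) * (y n / x (i + 1) + 1 / yb (i + 1)))
      else
        yb (i + 1) * (Vf n x xb y yb i / xb (i + 1)
          + (lev n x xb - lev n y yb) * (1 / x (i + 1) + 1 / yb (i + 1)))

/-- `σ_1` (first component): swap the indices `1` of the two families. -/
def sw1 {F : Type*} (x xb : ℕ → F) : ℕ → F := fun i => if i = 1 then xb 1 else x i

/-- `σ_n` on the unbarred family. -/
def snx {F : Type*} [Field F] (n : ℕ) (x : ℕ → F) : ℕ → F :=
  fun i => if i = n - 1 then x (n - 1) * x n else if i = n then (x n)⁻¹ else x i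

/-- `σ_n` on the barred family. -/
def snxb {F : Type*} [Field F] (n : ℕ) (x xb : ℕ → F) : ℕ → F :=
  fun i => if i = n - 1 then xb (n - 1) * x n else xb i

/-- `σ✶` (unbarred part of the first component of `σ✶(x,y)`, built from `y`). -/
def stx {F : Type*} (n : ℕ) (y yb : ℕ → F) : ℕ → F := fun i => if i = n then y n else yb i

/-- `V_i^{σ_1}`. -/
def Vs1 {F : Type*} [Field F] (n : ℕ) (x xb y yb : ℕ → F) : ℕ → F :=
  Vf n (sw1 x xb) (sw1 xb x) (sw1 y yb) (sw1 yb y)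

/-- `V_i^{σ_n}`. -/
def Vsn {F : Type*} [Field F] (n : ℕ) (x xb y yb : ℕ → F) : ℕ → F :=
  Vf n (snx n x) (snxb n x xb) (snx n y) (snxb n y yb)

/-- `V_i^{σ✶}`. -/
def Vst {F : Type*} [Field F] (n : ℕ) (x xb y yb : ℕ → F) : ℕ → F :=
  Vf n (stx n y yb) y (stx n x xb) x

/-- The functions `U_1, …, U_{n-1}` of the `D^(1)_n` tropical `R`. -/
def Uf {F : Type*} [Field F] (n : ℕ) (x xb y yb : ℕ → F) : ℕ → F := fun i =>
  if i = 1 then Vf n x xb y yb 0 * Vs1 n x xb y yb 0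
  else if i = n - 1 then Vf n x xb y yb (n - 1) * Vst n x xb y yb (n - 1)
  else (1 / x i + 1 / yb i)⁻¹ *
    (Vf n x xb y yb i * Vst n x xb y yb (i - 1) / y i
      + Vf n x xb y yb (i - 1) * Vst n x xb y yb i / xb i)

/-- unbarred part `x'` of the output of the tropical `R`. -/
def Rx {F : Type*} [Field F] (n : ℕ) (x xb y yb : ℕ → F) : ℕ → F := fun i =>
  if i = 1 then y 1 * Vs1 n x xb y yb 0 / Vf n x xb y yb 1
  else if i = n then y n * Vf n x xb y yb (n - 1) / Vsn n x xb y yb (n - 1)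
  else y i * Vf n x xb y yb (i - 1) * Uf n x xb y yb i
        / (Vf n x xb y yb i * Uf n x xb y yb (i - 1))

/-- barred part `x̄'` of the output of the tropical `R`. -/
def Rxb {F : Type*} [Field F] (n : ℕ) (x xb y yb : ℕ → F) : ℕ → F := fun i =>
  if i = 1 then yb 1 * Vf n x xb y yb 0 / Vf n x xb y yb 1
  else yb i * Vf n x xb y yb (i - 1) / Vf n x xb y yb i

/-- unbarred part `y'` of the output of the tropical `R`. -/
def Ry {F : Type*} [Field F] (n : ℕ) (x xb y yb : ℕ → F) : ℕ → F := fun i =>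
  if i = 1 then x 1 * Vf n x xb y yb 0 / Vst n x xb y yb 1
  else if i = n then x n * Vsn n x xb y yb (n - 1) / Vf n x xb y yb (n - 1)
  else x i * Vst n x xb y yb (i - 1) / Vst n x xb y yb i

/-- barred part `ȳ'` of the output of the tropical `R`. -/
def Ryb {F : Type*} [Field F] (n : ℕ) (x xb y yb : ℕ → F) : ℕ → F := fun i =>
  if i = 1 then xb 1 * Vs1 n x xb y yb 0 / Vst n x xb y yb 1
  else xb i * Vst n x xb y yb (i - 1) * Uf n x xb y yb i
        / (Vst n x xb y yb i * Uf n x xb y yb (i - 1))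

/-- Admissibility: all the quantities `V_i`, `U_i` and their `σ`-transforms appearing in
the formulas of the tropical `R` are nonzero. -/
def Adm {F : Type*} [Field F] (n : ℕ) (x xb y yb : ℕ → F) : Prop :=
  (∀ i ≤ n - 1, Vf n x xb y yb i ≠ 0) ∧
  (∀ i ≤ n - 1, Vst n x xb y yb i ≠ 0) ∧
  Vs1 n x xb y yb 0 ≠ 0 ∧
  Vsn n x xb y yb (n - 1) ≠ 0 ∧
  (∀ i, 1 ≤ i → i ≤ n - 1 → Uf n x xb y yb i ≠ 0)

/-- The unbarred part of `[μ; τ, C, τ']`. -/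
def brkX {F : Type*} [Field F] (n : ℕ) (μ τ C τ' : ℕ → F) : ℕ → F := fun i =>
  if i = 1 then (μ 1)⁻¹ * (τ 0 * τ' 1 / C 1)
  else if i = 2 then (μ 2)⁻¹ * (C 1 * τ' 2 / (C 2 * τ' 0 * τ' 1))
  else if i = n - 1 then (μ (n - 1))⁻¹ * (C (n - 2) * τ' (n - 1) / (τ (n - 1) * τ' (n - 2)))
  else if i = n then (μ n)⁻¹ * (τ (n - 1) * τ' n / (τ n * τ' (n - 1)))
  else (μ i)⁻¹ * (C (i - 1) * τ' i / (C i * τ' (i - 1)))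

/-- The barred part of `[μ; τ, C, τ']` (here `μb` is the barred part of `μ`). -/
def brkXb {F : Type*} [Field F] (n : ℕ) (μb τ C τ' : ℕ → F) : ℕ → F := fun i =>
  if i = 1 then (μb 1)⁻¹ * (τ 1 * τ' 0 / C 1)
  else if i = 2 then (μb 2)⁻¹ * (C 1 * τ 2 / (C 2 * τ 0 * τ 1))
  else if i = n - 1 then (μb (n - 1))⁻¹ * (C (n - 2) * τ n / (τ (n - 2) * τ' n))
  else (μb i)⁻¹ * (C (i - 1) * τ i / (C i * τ (i - 1)))

/-- Two solutions `(C, τ')`, `(D, σ)` of `[μ;τ,C,τ'] = z` with the same `τ` and `τ'_0 = σ_0`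
coincide. -/
theorem brk_solution_unique {F : Type*} [Field F] {n : ℕ} (hn : 4 ≤ n) {μ μb : ℕ → F}
    (hμ : ∀ i, 1 ≤ i → i ≤ n → μ i ≠ 0) (hμb : ∀ i, 1 ≤ i → i ≤ n - 1 → μb i ≠ 0)
    {τ C τ' D σ : ℕ → F} (hτ : ∀ i ≤ n, τ i ≠ 0)
    (hC : ∀ i, 1 ≤ i → i ≤ n - 2 → C i ≠ 0) (hτ' : ∀ i ≤ n, τ' i ≠ 0)
    (hD : ∀ i, 1 ≤ i → i ≤ n - 2 → D i ≠ 0) (hσ : ∀ i ≤ n, σ i ≠ 0) (h0 : τ' 0 = σ 0)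
    (hX : ∀ i, 1 ≤ i → i ≤ n → brkX n μ τ C τ' i = brkX n μ τ D σ i)
    (hXb : ∀ i, 1 ≤ i → i ≤ n - 1 → brkXb n μb τ C τ' i = brkXb n μb τ D σ i) :
    (∀ i, 1 ≤ i → i ≤ n - 2 → C i = D i) ∧ (∀ i ≤ n, τ' i = σ i) := by
  obtain ⟨m, rfl⟩ : ∃ m, n = m + 4 := ⟨n - 4, by omega⟩
  simp only [show m + 4 - 1 = m + 3 by omega, show m + 4 - 2 = m + 2 by omega] at *
  have key : ∀ i, i ≤ m + 1 → C (i + 1) = D (i + 1) ∧ τ' (i + 1) = σ (i + 1) := by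
    intro i
    induction i with
    | zero =>
      intro _
      have hb := hXb 1 le_rfl (by omega)
      have ha := hX 1 le_rfl (by omega)
      have := hμ 1 le_rfl (by omega)
      have := hμb 1 le_rfl (by omega)
      have := hτ 0 (by omega)
      have := hτ 1 (by omega)
      have := hC 1 le_rfl (by omega)
      have := hD 1 le_rfl (by omega)
      have := hσ 0 (by omega)
      simp only [brkX, brkXb, if_true, h0] at ha hb
      have hCD : C 1 = D 1 := by field_simp at hb; exact hb.symm
      rw [hCD] at ha
      exact ⟨hCD, by field_simp at ha; exact ha⟩
    | succ i ih =>
      intro hi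
      obtain ⟨ihC, ihτ⟩ := ih (by omega)
      have hb := hXb (i + 2) (by omega) (by omega)
      have ha := hX (i + 2) (by omega) (by omega)
      have := hμ (i + 2) (by omega) (by omega)
      have := hμb (i + 2) (by omega) (by omega)
      have := hτ 0 (by omega)
      have := hτ (i + 1) (by omega)
      have := hτ (i + 2) (by omega)
      have := hC (i + 2) (by omega) (by omega)
      have := hD (i + 2) (by omega) (by omega)
      have := hD (i + 1) (by omega) (by omega)
      have := hσ 0 (by omega)
      have := hσ (i + 1) (by omega)
      rcases Nat.eq_zero_or_pos i with rfl | hi0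
      · simp only [brkX, brkXb, zero_add, OfNat.ofNat_ne_one, if_true, if_false, h0] at *
        rw [ihC] at hb
        have hCD : C 2 = D 2 := by field_simp at hb; exact hb.symm
        rw [hCD, ihC, ihτ] at ha
        exact ⟨hCD, by field_simp at ha; exact ha⟩
      · simp only [brkX, brkXb, show i + 2 ≠ 1 by omega, show i + 2 ≠ 2 by omega,
          show i + 2 ≠ m + 4 - 1 by omega, show i + 2 ≠ m + 4 by omega, if_false,
          show i + 2 - 1 = i + 1 by omega] at ha hb
        rw [ihC] at hb
        have hCD : C (i + 2) = D (i + 2) := by field_simp at hb; exact hb.symm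
        rw [hCD, ihC, ihτ] at ha
        exact ⟨hCD, by field_simp at ha; exact ha⟩
  obtain ⟨hCm, hτm⟩ := key (m + 1) le_rfl
  have := hD (m + 2) (by omega) (by omega)
  have := hτ (m + 2) (by omega)
  have := hτ (m + 3) (by omega)
  have := hτ (m + 4) (by omega)
  have := hσ (m + 2) (by omega)
  have := hτ' (m + 4) (by omega)
  have := hσ (m + 4) (by omega)
  have hpen : τ' (m + 3) = σ (m + 3) := by
    have ha := hX (m + 3) (by omega) (by omega)
    have := hμ (m + 3) (by omega) (by omega)
    simp only [brkX, show m + 3 ≠ 1 by omega, show m + 3 ≠ 2 by omega,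
      show m + 4 - 1 = m + 3 by omega, show m + 4 - 2 = m + 2 by omega, if_true, if_false] at ha
    rw [hCm, hτm] at ha
    field_simp at ha
    exact ha
  have hlast : τ' (m + 4) = σ (m + 4) := by
    have hb := hXb (m + 3) (by omega) (by omega)
    have := hμb (m + 3) (by omega) (by omega)
    simp only [brkXb, show m + 3 ≠ 1 by omega, show m + 3 ≠ 2 by omega,
      show m + 4 - 1 = m + 3 by omega, show m + 4 - 2 = m + 2 by omega, if_true, if_false] at hb
    rw [hCm] at hb
    field_simp at hb
    exact hb.symm
  refine ⟨fun i h1 h2 => ?_, fun i hi => ?_⟩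
  · obtain ⟨j, rfl⟩ := Nat.exists_eq_add_of_le' h1
    exact (key j (by omega)).1
  · rcases i with _ | j
    · exact h0
    · rcases (show j ≤ m + 1 ∨ j = m + 2 ∨ j = m + 3 by omega) with h | rfl | rfl
      exacts [(key j h).2, hpen, hlast]

/-- A solution `(C, τ')` of `[μ;τ,C,τ'] = z` with prescribed `τ'_0`. -/
theorem exists_brk_solution {F : Type*} [Field F] {n : ℕ} (hn : 4 ≤ n) {μ μb z zb : ℕ → F}
    (hμ : ∀ i, 1 ≤ i → i ≤ n → μ i ≠ 0) (hμb : ∀ i, 1 ≤ i → i ≤ n - 1 → μb i ≠ 0)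
    (hz : ∀ i, 1 ≤ i → i ≤ n → z i ≠ 0) (hzb : ∀ i, 1 ≤ i → i ≤ n - 1 → zb i ≠ 0)
    (hlev : lev n z zb = (lev n μ μb)⁻¹)
    {τ : ℕ → F} (hτ : ∀ i ≤ n, τ i ≠ 0) {c : F} (hc : c ≠ 0) :
    ∃ C τ' : ℕ → F, τ' 0 = c ∧
      (∀ i, 1 ≤ i → i ≤ n - 2 → C i ≠ 0) ∧ (∀ i ≤ n, τ' i ≠ 0) ∧
      (∀ i, 1 ≤ i → i ≤ n → brkX n μ τ C τ' i = z i) ∧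
      (∀ i, 1 ≤ i → i ≤ n - 1 → brkXb n μb τ C τ' i = zb i) := by
  obtain ⟨m, rfl⟩ : ∃ m, n = m + 4 := ⟨n - 4, by omega⟩
  simp only [show m + 4 - 1 = m + 3 by omega, show m + 4 - 2 = m + 2 by omega] at *
  obtain ⟨A, hA⟩ : ∃ A : ℕ → F, A = fun i => ∏ j ∈ Finset.Icc 1 i, μ j * z j := ⟨_, rfl⟩
  obtain ⟨B, hB⟩ : ∃ B : ℕ → F, B = fun i => ∏ j ∈ Finset.Icc 1 i, μb j * zb j := ⟨_, rfl⟩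
  have hA1 : A 1 = μ 1 * z 1 := by simp [hA]
  have hB1 : B 1 = μb 1 * zb 1 := by simp [hB]
  have hAs : ∀ i, A (i + 1) = A i * (μ (i + 1) * z (i + 1)) := fun i => by
    simp only [hA]; exact Finset.prod_Icc_succ_top (by omega) _
  have hBs : ∀ i, B (i + 1) = B i * (μb (i + 1) * zb (i + 1)) := fun i => by
    simp only [hB]; exact Finset.prod_Icc_succ_top (by omega) _
  have hA0 : ∀ i ≤ m + 4, A i ≠ 0 := fun i hi => by
    simp only [hA, Finset.prod_ne_zero_iff, Finset.mem_Icc]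
    exact fun j hj => mul_ne_zero (hμ j hj.1 (by omega)) (hz j hj.1 (by omega))
  have hB0 : ∀ i ≤ m + 3, B i ≠ 0 := fun i hi => by
    simp only [hB, Finset.prod_ne_zero_iff, Finset.mem_Icc]
    exact fun j hj => mul_ne_zero (hμb j hj.1 (by omega)) (hzb j hj.1 (by omega))
  have hAB : A (m + 4) * B (m + 3) = 1 := by
    have hne : lev (m + 4) μ μb ≠ 0 := by
      simp only [lev, mul_ne_zero_iff, Finset.prod_ne_zero_iff, Finset.mem_Icc]
      exact ⟨fun j hj => hμ j hj.1 hj.2, fun j hj => hμb j hj.1 hj.2⟩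
    rw [← inv_mul_cancel₀ hne, ← hlev]
    simp only [hA, hB, lev, Finset.prod_mul_distrib, show m + 4 - 1 = m + 3 by omega]
    ring
  clear hA hB hlev
  have t0 := hτ 0 (by omega)
  refine ⟨fun i => if i = 1 then τ 1 * c / B 1 else c * τ i / (τ 0 * B i),
    fun i => if i = 0 then c else if i = 1 then A 1 * (τ 1 * c / B 1) / τ 0
      else if i = m + 4 then c * τ (m + 4) / (τ 0 * B (m + 3))
      else if i = m + 3 then A (m + 3) * τ (m + 3) * c / τ 0
      else A i * (c * τ i / (τ 0 * B i)) * c / τ 0, rfl, ?_, ?_, ?_, ?_⟩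
  · intro i h1 h2
    have := hτ 1 (by omega)
    have := hτ i (by omega)
    have := hB0 1 (by omega)
    have := hB0 i (by omega)
    dsimp only
    split_ifs <;> simp_all
  · intro i hi
    have := hτ i hi
    have := hτ 1 (by omega)
    have := hτ (m + 3) (by omega)
    have := hτ (m + 4) (by omega)
    have := hA0 1 (by omega)
    have := hA0 i hi
    have := hA0 (m + 3) (by omega)
    have := hB0 1 (by omega)
    have := hB0 (m + 3) (by omega)
    dsimp only
    split_ifs with h1 h2 h3 h4
    · exact hc
    · positivity
    · positivity
    · positivity
    · have := hB0 i (by omega)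
      positivity
  · intro i h1 h2
    obtain ⟨j, rfl⟩ := Nat.exists_eq_add_of_le' h1
    have := hμ (j + 1) (by omega) h2
    have := hz (j + 1) (by omega) h2
    have := hτ 1 (by omega)
    have := hB0 1 (by omega)
    have := hA0 j (by omega)
    have := hτ j (by omega)
    have := hτ (j + 1) h2
    rcases (show j = 0 ∨ j = 1 ∨ j = m + 2 ∨ j = m + 3 ∨ (2 ≤ j ∧ j ≤ m + 1) by omega) with
      rfl | rfl | rfl | rfl | ⟨hj, hj'⟩
    · simp [brkX, hA1] at *
      field_simp
    · have := hB0 2 (by omega)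
      have := hAs 1
      simp [brkX, hA1] at *
      field_simp
      grind
    · have := hB0 (m + 2) (by omega)
      simp [brkX, hAs (m + 2)]
      field_simp
    · have := hB0 (m + 3) (by omega)
      rw [hAs (m + 3)] at hAB
      simp [brkX]
      field_simp
      linear_combination -hAB
    · have := hB0 j (by omega)
      have := hB0 (j + 1) (by omega)
      simp [brkX, show j ≠ 0 by omega, show j ≠ 1 by omega, show j ≠ m + 2 by omega,
        show j ≠ m + 3 by omega, show j ≠ m + 4 by omega, hAs j]
      field_simp
  · intro i h1 h2
    obtain ⟨j, rfl⟩ := Nat.exists_eq_add_of_le' h1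
    have := hμb (j + 1) (by omega) h2
    have := hzb (j + 1) (by omega) h2
    have := hτ 1 (by omega)
    have := hB0 1 (by omega)
    have := hB0 j (by omega)
    have := hτ j (by omega)
    have := hτ (j + 1) (by omega)
    rcases (show j = 0 ∨ j = 1 ∨ j = m + 2 ∨ (2 ≤ j ∧ j ≤ m + 1) by omega) with
      rfl | rfl | rfl | ⟨hj, hj'⟩
    · simp [brkXb, hB1] at *
      field_simp
    · have := hBs 1
      simp [brkXb] at *
      field_simp
      grind
    · have := hτ (m + 4) (by omega)
      simp [brkXb, hBs (m + 2)]
      field_simp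
    · simp [brkXb, show j ≠ 0 by omega, show j ≠ 1 by omega, show j ≠ m + 2 by omega, hBs j]
      field_simp

/-- Exchanging `τ` and `τ'`, together with the indices `n - 1` and `n`, exchanges the barred and
unbarred parts of `[μ;τ,C,τ']` and fixes its `n`-th entry. -/
theorem brkX_comp_swap {F : Type*} [Field F] {n : ℕ} (hn : 4 ≤ n) (μ μb τ C τ' : ℕ → F)
    {i : ℕ} (hi : i ≤ n) :
    brkX n (stx n μ μb) (τ' ∘ Equiv.swap (n - 1) n) C (τ ∘ Equiv.swap (n - 1) n) i =
      stx n (brkX n μ τ C τ') (brkXb n μb τ C τ') i := by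
  obtain ⟨m, rfl⟩ : ∃ m, n = m + 4 := ⟨n - 4, by omega⟩
  have hs : ∀ j, j < m + 3 → Equiv.swap (m + 3) (m + 4) j = j := fun j hj =>
    Equiv.swap_apply_of_ne_of_ne (by omega) (by omega)
  rcases (show i = 1 ∨ i = 2 ∨ i = m + 3 ∨ i = m + 4 ∨ i = 0 ∨ (3 ≤ i ∧ i ≤ m + 2) by omega) with
    rfl | rfl | rfl | rfl | rfl | ⟨h, h'⟩
  · simp [brkX, brkXb, stx, hs]; left; ring
  · simp [brkX, brkXb, stx, hs]
  · simp [brkX, brkXb, stx, hs]; left; ring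
  · simp [brkX, stx]; left; ring
  · simp [brkX, brkXb, stx, hs]
  · simp [brkX, brkXb, stx, hs i (by omega), hs (i - 1) (by omega), show i ≠ 1 by omega,
      show i ≠ 2 by omega, show i ≠ m + 3 by omega, show i ≠ m + 4 by omega]

theorem brkXb_comp_swap {F : Type*} [Field F] {n : ℕ} (hn : 4 ≤ n) (μ τ C τ' : ℕ → F)
    {i : ℕ} (hi : i ≤ n - 1) :
    brkXb n μ (τ' ∘ Equiv.swap (n - 1) n) C (τ ∘ Equiv.swap (n - 1) n) i =
      brkX n μ τ C τ' i := by
  obtain ⟨m, rfl⟩ : ∃ m, n = m + 4 := ⟨n - 4, by omega⟩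
  have hs : ∀ j, j < m + 3 → Equiv.swap (m + 3) (m + 4) j = j := fun j hj =>
    Equiv.swap_apply_of_ne_of_ne (by omega) (by omega)
  rcases (show i = 1 ∨ i = 2 ∨ i = m + 3 ∨ i = 0 ∨ (3 ≤ i ∧ i ≤ m + 2) by omega) with
    rfl | rfl | rfl | rfl | ⟨h, h'⟩
  · simp [brkX, brkXb, hs]; left; ring
  · simp [brkX, brkXb, hs]
  · simp [brkX, brkXb, hs]; left; ring
  · simp [brkX, brkXb, hs]
  · simp [brkX, brkXb, hs i (by omega), hs (i - 1) (by omega), show i ≠ 1 by omega,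
      show i ≠ 2 by omega, show i ≠ m + 3 by omega, show i ≠ m + 4 by omega]

theorem lev_stx {F : Type*} [Field F] {n : ℕ} (hn : 1 ≤ n) (x xb : ℕ → F) :
    lev n (stx n x xb) x = lev n x xb := by
  obtain ⟨m, rfl⟩ := Nat.exists_eq_add_of_le' hn
  have h : ∏ i ∈ Finset.Icc 1 m, stx (m + 1) x xb i = ∏ i ∈ Finset.Icc 1 m, xb i :=
    Finset.prod_congr rfl fun i hi => by
      rw [Finset.mem_Icc] at hi
      simp [stx, show i ≠ m + 1 by omega]
  simp only [lev, Nat.add_sub_cancel, Finset.prod_Icc_succ_top (show 1 ≤ m + 1 by omega), h]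
  simp only [stx, if_true]
  ring

theorem stx_ne_zero {F : Type*} [Field F] {n : ℕ} {x xb : ℕ → F}
    (hx : ∀ i, 1 ≤ i → i ≤ n → x i ≠ 0) (hxb : ∀ i, 1 ≤ i → i ≤ n - 1 → xb i ≠ 0) :
    ∀ i, 1 ≤ i → i ≤ n → stx n x xb i ≠ 0 := by
  intro i h1 h2
  unfold stx
  split_ifs with h
  · exact hx n (by omega) le_rfl
  · exact hxb i h1 (by omega)

theorem stmt10 {F : Type*} [Field F] (n : ℕ) (hn : 4 ≤ n)
    (μ μb : ℕ → F)
    (hμ : ∀ i, 1 ≤ i → i ≤ n → μ i ≠ 0)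
    (hμb : ∀ i, 1 ≤ i → i ≤ n - 1 → μb i ≠ 0)
    (z zb : ℕ → F)
    (hz : ∀ i, 1 ≤ i → i ≤ n → z i ≠ 0)
    (hzb : ∀ i, 1 ≤ i → i ≤ n - 1 → zb i ≠ 0)
    (hlev : lev n z zb = (lev n μ μb)⁻¹) :
    -- fixing τ and solving for (C, τ')
    (∀ τ : ℕ → F, (∀ i ≤ n, τ i ≠ 0) →
      ∀ c : F, c ≠ 0 →
        ∃ C τ' : ℕ → F,
          (τ' 0 = c ∧
            (∀ i, 1 ≤ i → i ≤ n - 2 → C i ≠ 0) ∧ (∀ i ≤ n, τ' i ≠ 0) ∧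
            (∀ i, 1 ≤ i → i ≤ n → brkX n μ τ C τ' i = z i) ∧
            (∀ i, 1 ≤ i → i ≤ n - 1 → brkXb n μb τ C τ' i = zb i)) ∧
          ∀ C' τ'' : ℕ → F,
            τ'' 0 = c →
            (∀ i, 1 ≤ i → i ≤ n - 2 → C' i ≠ 0) → (∀ i ≤ n, τ'' i ≠ 0) →
            (∀ i, 1 ≤ i → i ≤ n → brkX n μ τ C' τ'' i = z i) →
            (∀ i, 1 ≤ i → i ≤ n - 1 → brkXb n μb τ C' τ'' i = zb i) →
            (∀ i, 1 ≤ i → i ≤ n - 2 → C' i = C i) ∧ (∀ i ≤ n, τ'' i = τ' i)) ∧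
    -- fixing τ' and solving for (C, τ)
    (∀ τ' : ℕ → F, (∀ i ≤ n, τ' i ≠ 0) →
      ∀ c : F, c ≠ 0 →
        ∃ C τ : ℕ → F,
          (τ 0 = c ∧
            (∀ i, 1 ≤ i → i ≤ n - 2 → C i ≠ 0) ∧ (∀ i ≤ n, τ i ≠ 0) ∧
            (∀ i, 1 ≤ i → i ≤ n → brkX n μ τ C τ' i = z i) ∧
            (∀ i, 1 ≤ i → i ≤ n - 1 → brkXb n μb τ C τ' i = zb i)) ∧
          ∀ C' τ'' : ℕ → F,
            τ'' 0 = c →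
            (∀ i, 1 ≤ i → i ≤ n - 2 → C' i ≠ 0) → (∀ i ≤ n, τ'' i ≠ 0) →
            (∀ i, 1 ≤ i → i ≤ n → brkX n μ τ'' C' τ' i = z i) →
            (∀ i, 1 ≤ i → i ≤ n - 1 → brkXb n μb τ'' C' τ' i = zb i) →
            (∀ i, 1 ≤ i → i ≤ n - 2 → C' i = C i) ∧ (∀ i ≤ n, τ'' i = τ i)) := by
  constructor
  · intro τ hτ c hc
    obtain ⟨C, τ', h0, hC, hτ', hX, hXb⟩ := exists_brk_solution hn hμ hμb hz hzb hlev hτ hc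
    refine ⟨C, τ', ⟨h0, hC, hτ', hX, hXb⟩, fun D σ hσ0 hD hσ hDX hDXb => ?_⟩
    exact brk_solution_unique hn hμ hμb hτ hD hσ hC hτ' (hσ0.trans h0.symm)
      (fun i h1 h2 => (hDX i h1 h2).trans (hX i h1 h2).symm)
      (fun i h1 h2 => (hDXb i h1 h2).trans (hXb i h1 h2).symm)
  · intro τ' hτ' c hc
    have hswap : ∀ i ≤ n, Equiv.swap (n - 1) n i ≤ n := fun i hi => by
      rw [Equiv.swap_apply_def]; split_ifs <;> omega
    have hswap0 : Equiv.swap (n - 1) n 0 = 0 :=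
      Equiv.swap_apply_of_ne_of_ne (by omega) (by omega)
    have hμ' : ∀ i, 1 ≤ i → i ≤ n - 1 → μ i ≠ 0 := fun i h1 h2 => hμ i h1 (by omega)
    have hz' : ∀ i, 1 ≤ i → i ≤ n - 1 → z i ≠ 0 := fun i h1 h2 => hz i h1 (by omega)
    have hsτ' : ∀ i ≤ n, (τ' ∘ Equiv.swap (n - 1) n) i ≠ 0 := fun i hi => hτ' _ (hswap i hi)
    have hlev' : lev n (stx n z zb) z = (lev n (stx n μ μb) μ)⁻¹ := by
      rwa [lev_stx (by omega), lev_stx (by omega)]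
    obtain ⟨C, σ, h0, hC, hσ, hX, hXb⟩ := exists_brk_solution hn (stx_ne_zero hμ hμb) hμ'
      (stx_ne_zero hz hzb) hz' hlev' hsτ' hc
    have hσσ : (σ ∘ Equiv.swap (n - 1) n) ∘ Equiv.swap (n - 1) n = σ := by
      funext i; simp
    rw [← hσσ] at hX hXb
    refine ⟨C, σ ∘ Equiv.swap (n - 1) n, ⟨by simp [hswap0, h0], hC,
      fun i hi => hσ _ (hswap i hi), fun i h1 h2 => ?_, fun i h1 h2 => ?_⟩,
      fun D ρ hρ0 hD hρ hDX hDXb => ?_⟩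
    · rcases h2.eq_or_lt with rfl | h2
      · simpa [brkX_comp_swap hn, stx] using hX i h1 le_rfl
      · rw [← brkXb_comp_swap hn μ _ C τ' (by omega)]
        exact hXb i h1 (by omega)
    · have h := hX i h1 (by omega)
      rw [brkX_comp_swap hn _ _ _ _ _ (by omega)] at h
      simpa [stx, show i ≠ n by omega] using h
    · have hu := brk_solution_unique (σ := σ) (D := C) (C := D)
        (τ' := ρ ∘ Equiv.swap (n - 1) n) hn (stx_ne_zero hμ hμb) hμ' hsτ' hD
        (fun i hi => hρ _ (hswap i hi)) hC hσ (by simp [hswap0, hρ0, h0])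
        (fun i h1 h2 => ?_) (fun i h1 h2 => ?_)
      · refine ⟨hu.1, fun i hi => ?_⟩
        simpa using hu.2 _ (hswap i hi)
      · rw [← hσσ, hX i h1 h2, brkX_comp_swap hn _ _ _ _ _ h2]
        unfold stx
        split_ifs with h
        · exact hDX n (by omega) le_rfl
        · exact hDXb i h1 (by omega)
      · rw [← hσσ, hXb i h1 h2, brkXb_comp_swap hn _ _ _ _ h2]
        exact hDX i h1 (by omega)
end
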